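/- Let d, l, m be positive integers with d ≥ 2 and d dividing m, let p_1, …, p_l be distinct complex numbers, and let a_1, …, a_l be positive integers with a_1 + ⋯ + a_l = m. Assume that either (i) d is even and l ≥ m/d + 2, or (ii) d is odd and l ≥ m/d + 1. Then for all entire functions g, h : ℂ → ℂ satisfying h(z)^d = ∏_{i=1}^{l} (g(z) − p_i)^{a_i} for all z ∈ ℂ, both g and h are constant. -/

import Mathlib

open Filter Topology Complex

/-- `f` has second derivative `c` at `x`, being differentiable around `x`. -/
def HasSecondDerivAt (f : ℝ → ℝ) (c x : ℝ) : Prop :=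
  ∃ f' : ℝ → ℝ, (∀ᶠ t in 𝓝 x, HasDerivAt f (f' t) t) ∧ HasDerivAt f' c x

lemma HasSecondDerivAt.add {f g : ℝ → ℝ} {c d x : ℝ} (hf : HasSecondDerivAt f c x)
    (hg : HasSecondDerivAt g d x) : HasSecondDerivAt (fun t => f t + g t) (c + d) x := by
  obtain ⟨f', hf, hf'⟩ := hf
  obtain ⟨g', hg, hg'⟩ := hg
  refine ⟨fun t => f' t + g' t, ?_, hf'.add hg'⟩
  filter_upwards [hf, hg] with t h₁ h₂ using h₁.add h₂

lemma HasSecondDerivAt.sum {ι : Type*} {J : Finset ι} {f : ι → ℝ → ℝ} {c : ι → ℝ} {x : ℝ}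
    (hf : ∀ j ∈ J, HasSecondDerivAt (f j) (c j) x) :
    HasSecondDerivAt (fun t => ∑ j ∈ J, f j t) (∑ j ∈ J, c j) x := by
  classical
  induction J using Finset.induction_on with
  | empty =>
    exact ⟨fun _ => 0, Eventually.of_forall fun t => by simpa using hasDerivAt_const t (0 : ℝ),
      by simpa using hasDerivAt_const x (0 : ℝ)⟩
  | insert j J hj ih =>
    simp only [Finset.sum_insert hj]
    exact (hf j (Finset.mem_insert_self _ _)).add
      (ih fun i hi => hf i (Finset.mem_insert_of_mem hi))

lemma HasSecondDerivAt.nonpos_of_isLocalMax {f : ℝ → ℝ} {c x : ℝ} (hf : HasSecondDerivAt f c x)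
    (hmax : IsLocalMax f x) : c ≤ 0 := by
  obtain ⟨f', hf, hf'⟩ := hf
  by_contra! hc
  have hd : deriv f =ᶠ[𝓝 x] f' := hf.mono fun t ht => ht.deriv
  have hdd : deriv (deriv f) x = c := by rw [hd.deriv_eq, hf'.deriv]
  have hmin : IsLocalMin f x :=
    isLocalMin_of_deriv_deriv_pos (hdd ▸ hc) hmax.deriv_eq_zero hf.self_of_nhds.continuousAt
  have hconst : f =ᶠ[𝓝 x] fun _ => f x := by
    filter_upwards [hmax, hmin] with t h₁ h₂ using le_antisymm h₁ h₂
  have : deriv (deriv f) x = 0 := by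
    rw [hconst.deriv.deriv_eq]; simp
  linarith

lemma AnalyticAt.hasSecondDerivAt_comp_normSq {u : ℂ → ℂ} {z₀ : ℂ} (hu : AnalyticAt ℂ u z₀)
    {φ φ' : ℝ → ℝ} {c : ℝ}
    (hφ : ∀ᶠ x in 𝓝 (normSq (u z₀)), HasDerivAt φ (φ' x) x)
    (hφ' : HasDerivAt φ' c (normSq (u z₀))) (ζ : ℂ) :
    HasSecondDerivAt (fun t : ℝ => φ (normSq (u (z₀ + t * ζ))))
      (c * (2 * ((u z₀).re * (deriv u z₀ * ζ).re + (u z₀).im * (deriv u z₀ * ζ).im)) ^ 2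
        + φ' (normSq (u z₀)) * (2 * (normSq (deriv u z₀ * ζ)
          + (u z₀).re * (deriv (deriv u) z₀ * ζ * ζ).re
          + (u z₀).im * (deriv (deriv u) z₀ * ζ * ζ).im))) 0 := by
  have hγ (t : ℝ) : HasDerivAt (fun t : ℝ => z₀ + t * ζ) ζ t := by
    simpa using ((hasDerivAt_id t).ofReal_comp.mul_const ζ).const_add z₀
  have hγ0 : Tendsto (fun t : ℝ => z₀ + t * ζ) (𝓝 0) (𝓝 z₀) := by
    simpa using (hγ 0).continuousAt.tendsto
  have key {v : ℂ → ℂ} {t : ℝ} (hv : DifferentiableAt ℂ v (z₀ + t * ζ)) :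
      HasDerivAt (fun t : ℝ => (v (z₀ + t * ζ)).re) (deriv v (z₀ + t * ζ) * ζ).re t ∧
      HasDerivAt (fun t : ℝ => (v (z₀ + t * ζ)).im) (deriv v (z₀ + t * ζ) * ζ).im t := by
    have h := hv.hasDerivAt.comp t (hγ t)
    exact ⟨reCLM.hasFDerivAt.comp_hasDerivAt t h, imCLM.hasFDerivAt.comp_hasDerivAt t h⟩
  have hN {t : ℝ} (hv : DifferentiableAt ℂ u (z₀ + t * ζ)) :
      HasDerivAt (fun t : ℝ => normSq (u (z₀ + t * ζ)))
        (2 * ((u (z₀ + t * ζ)).re * (deriv u (z₀ + t * ζ) * ζ).re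
          + (u (z₀ + t * ζ)).im * (deriv u (z₀ + t * ζ) * ζ).im)) t := by
    obtain ⟨h₁, h₂⟩ := key hv
    simp only [normSq_apply]
    exact ((h₁.fun_mul h₁).fun_add (h₂.fun_mul h₂)).congr_deriv (by ring)
  refine ⟨fun t => φ' (normSq (u (z₀ + t * ζ))) *
    (2 * ((u (z₀ + t * ζ)).re * (deriv u (z₀ + t * ζ) * ζ).re
      + (u (z₀ + t * ζ)).im * (deriv u (z₀ + t * ζ) * ζ).im)), ?_, ?_⟩
  · have hcont : Tendsto (fun t : ℝ => normSq (u (z₀ + t * ζ))) (𝓝 0) (𝓝 (normSq (u z₀))) :=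
      (continuous_normSq.continuousAt.tendsto.comp hu.continuousAt.tendsto).comp hγ0
    filter_upwards [hγ0.eventually hu.eventually_analyticAt, hcont.eventually hφ] with t h₁ h₂
    exact h₂.comp t (hN h₁.differentiableAt)
  · have h0 : z₀ + ((0 : ℝ) : ℂ) * ζ = z₀ := by simp
    have hu0 : DifferentiableAt ℂ u (z₀ + ((0 : ℝ) : ℂ) * ζ) := by
      rw [h0]; exact hu.differentiableAt
    have hdu0 : DifferentiableAt ℂ (fun z => deriv u z * ζ) (z₀ + ((0 : ℝ) : ℂ) * ζ) := by
      rw [h0]; exact hu.deriv.differentiableAt.mul_const ζ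
    obtain ⟨h₁, h₂⟩ := key hu0
    obtain ⟨h₃, h₄⟩ := key hdu0
    have hφ0 : HasDerivAt φ' c (normSq (u (z₀ + ((0 : ℝ) : ℂ) * ζ))) := by rwa [h0]
    have hd : deriv (fun z => deriv u z * ζ) z₀ = deriv (deriv u) z₀ * ζ :=
      deriv_mul_const hu.deriv.differentiableAt ζ
    refine ((hφ0.comp 0 (hN hu0)).fun_mul
      (((h₁.fun_mul h₃).fun_add (h₂.fun_mul h₄)).const_mul 2)).congr_deriv ?_
    simp only [Function.comp_apply, h0, hd, normSq_apply]
    ring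

/-- The maximum principle for sums of functions of squared norms of holomorphic functions:
`4 |u'|² (φ' + |u|² φ'')` is the Laplacian of `φ (|u|²)`. -/
lemma sum_normSq_deriv_mul_nonpos_of_isLocalMax {ι : Type*} {J : Finset ι} {u : ι → ℂ → ℂ}
    {φ φ' : ι → ℝ → ℝ} {c : ι → ℝ} {z₀ : ℂ} (hu : ∀ j ∈ J, AnalyticAt ℂ (u j) z₀)
    (hφ : ∀ j ∈ J, ∀ᶠ x in 𝓝 (normSq (u j z₀)), HasDerivAt (φ j) (φ' j x) x)
    (hφ' : ∀ j ∈ J, HasDerivAt (φ' j) (c j) (normSq (u j z₀)))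
    (hmax : IsLocalMax (fun z => ∑ j ∈ J, φ j (normSq (u j z))) z₀) :
    ∑ j ∈ J, normSq (deriv (u j) z₀) *
      (φ' j (normSq (u j z₀)) + normSq (u j z₀) * c j) ≤ 0 := by
  have hdir (ζ : ℂ) := (HasSecondDerivAt.sum fun j hj =>
    (hu j hj).hasSecondDerivAt_comp_normSq (hφ j hj) (hφ' j hj) ζ).nonpos_of_isLocalMax (by
      have h : Tendsto (fun t : ℝ => z₀ + t * ζ) (𝓝 0) (𝓝 z₀) := by
        have : Continuous fun t : ℝ => z₀ + t * ζ := by fun_prop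
        simpa using this.tendsto 0
      filter_upwards [h.eventually hmax] with t ht
      simpa using ht)
  have h := add_nonpos (hdir 1) (hdir I)
  rw [← Finset.sum_add_distrib] at h
  have h4 : 4 * ∑ j ∈ J, normSq (deriv (u j) z₀) *
      (φ' j (normSq (u j z₀)) + normSq (u j z₀) * c j) ≤ 0 := by
    rw [Finset.mul_sum]
    refine le_of_eq_of_le (Finset.sum_congr rfl fun j _ => ?_) h
    simp only [normSq_apply, mul_re, mul_im, I_re, I_im, one_re, one_im]
    ring
  linarith

/-- The radial factor of a conformal density on the plane with a cone point at `0`,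
as a function of the squared modulus. -/
noncomputable def coneDensity (a b x : ℝ) : ℝ := x ^ (-a) * (1 + x ^ b)

lemma coneDensity_nonneg {a b x : ℝ} (hx : 0 ≤ x) : 0 ≤ coneDensity a b x := by
  unfold coneDensity; positivity

lemma coneDensity_pos {a b x : ℝ} (hx : 0 < x) : 0 < coneDensity a b x := by
  unfold coneDensity; positivity

lemma coneDensity_anti {a b x y : ℝ} (ha : 0 ≤ a) (hab : b ≤ a) (hx : 0 < x) (hxy : x ≤ y) :
    coneDensity a b y ≤ coneDensity a b x := by
  have h {t : ℝ} (ht : 0 < t) : coneDensity a b t = t ^ (-a) + t ^ (b - a) := by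
    rw [coneDensity, mul_add, mul_one, ← Real.rpow_add ht]; ring_nf
  rw [h hx, h (hx.trans_le hxy)]
  exact add_le_add (Real.rpow_le_rpow_of_nonpos hx hxy (by linarith))
    (Real.rpow_le_rpow_of_nonpos hx hxy (by linarith))

lemma coneDensity_mul_le {a b κ : ℝ} (hb : 0 ≤ b) (hκ : 0 < κ) {x : ℝ} (hx : 1 ≤ x) :
    coneDensity a b (κ * x) ≤ coneDensity a b κ * x ^ (b - a) := by
  have hx0 : 0 < x := by linarith
  have h1 : 1 ≤ x ^ b := Real.one_le_rpow hx hb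
  have : coneDensity a b κ * x ^ (b - a) = κ ^ (-a) * x ^ (-a) * (x ^ b + κ ^ b * x ^ b) := by
    rw [coneDensity, sub_eq_add_neg, Real.rpow_add hx0]; ring
  rw [this, coneDensity, Real.mul_rpow hκ.le hx0.le, Real.mul_rpow hκ.le hx0.le]
  gcongr

/-- The Laplacian of the logarithm of `coneDensity` along the squared modulus, up to a constant
factor. -/
noncomputable def coneCurvature (b x : ℝ) : ℝ := x ^ (b - 1) / (1 + x ^ b) ^ 2

lemma coneCurvature_nonneg {b x : ℝ} (hx : 0 ≤ x) : 0 ≤ coneCurvature b x := by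
  unfold coneCurvature; positivity

lemma coneDensity_mul_le_coneCurvature {a b t x : ℝ} (hb : 0 ≤ b) (hab : a + b ≤ 1)
    (ht : 1 + 2 * b - a ≤ t) (hx : 0 < x) :
    coneDensity a b x * (1 + x) ^ (-t) ≤ 8 * coneCurvature b x := by
  have h1 : 1 + x ^ b ≤ 2 * (1 + x) ^ b := by
    have h2 : x ^ b ≤ (1 + x) ^ b := Real.rpow_le_rpow hx.le (by linarith) hb
    have h3 : 1 ≤ (1 + x) ^ b := Real.one_le_rpow (by linarith) hb
    linarith
  have h2 : x ^ (1 - a - b) ≤ (1 + x) ^ (1 - a - b) :=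
    Real.rpow_le_rpow hx.le (by linarith) (by linarith)
  have hx1 : 0 < 1 + x := by linarith
  have h3 : (1 + x ^ b) ^ 3 * x ^ (1 - a - b) * (1 + x) ^ (-t) ≤ 8 := by
    calc (1 + x ^ b) ^ 3 * x ^ (1 - a - b) * (1 + x) ^ (-t)
        ≤ (2 * (1 + x) ^ b) ^ 3 * (1 + x) ^ (1 - a - b) * (1 + x) ^ (-t) := by gcongr
      _ = 8 * (1 + x) ^ (b * 3 + (1 - a - b) + -t) := by
        rw [Real.rpow_add hx1, Real.rpow_add hx1, Real.rpow_mul hx1.le]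
        norm_cast; ring
      _ ≤ 8 * 1 := by
        gcongr
        exact Real.rpow_le_one_of_one_le_of_nonpos (by linarith) (by linarith)
      _ = 8 := by norm_num
  have h4 : x ^ (-a) = x ^ (b - 1) * x ^ (1 - a - b) := by
    rw [← Real.rpow_add hx]; ring_nf
  rw [coneDensity, coneCurvature, mul_div_assoc', le_div_iff₀ (by positivity), h4]
  calc x ^ (b - 1) * x ^ (1 - a - b) * (1 + x ^ b) * (1 + x) ^ (-t) * (1 + x ^ b) ^ 2
      = x ^ (b - 1) * ((1 + x ^ b) ^ 3 * x ^ (1 - a - b) * (1 + x) ^ (-t)) := by ring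
    _ ≤ x ^ (b - 1) * 8 := by gcongr
    _ = 8 * x ^ (b - 1) := by ring

lemma Finset.exists_pos_forall_normSq_sub_ge (S : Finset ℂ) :
    ∃ δ > 0, ∀ p ∈ S, ∀ q ∈ S, p ≠ q → ∀ w, normSq (w - p) ≤ normSq (w - q) →
      δ ≤ normSq (w - q) := by
  obtain ⟨ε, hε, h⟩ : ∃ ε > 0, ∀ x ∈ S.offDiag, ε ≤ normSq (x.1 - x.2) := by
    rcases S.offDiag.eq_empty_or_nonempty with h | h
    · exact ⟨1, one_pos, by simp [h]⟩
    · obtain ⟨x, hx, hmin⟩ := S.offDiag.exists_min_image (fun x => normSq (x.1 - x.2)) h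
      exact ⟨_, normSq_pos.2 (sub_ne_zero.2 (Finset.mem_offDiag.1 hx).2.2), hmin⟩
  refine ⟨ε / 4, by positivity, fun p hp q hq hpq w hw => ?_⟩
  have h1 := h (p, q) (Finset.mem_offDiag.2 ⟨hp, hq, hpq⟩)
  have h2 : normSq (p - q) ≤ 2 * (normSq (w - p) + normSq (w - q)) := by
    simp only [normSq_apply, sub_re, sub_im]
    nlinarith [sq_nonneg ((w.re - p.re) + (w.re - q.re)),
      sq_nonneg ((w.im - p.im) + (w.im - q.im))]
  dsimp only at h1
  linarith

/-- Away from the cone points, the product of the cone densities has curvature bounded away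
from zero. -/
lemma exists_mul_prod_coneDensity_le {S : Finset ℂ} (hS : S.Nonempty) {a b : ℝ} (ha : 0 ≤ a)
    (hb : 0 ≤ b) (hba : b ≤ a) (hab : a + b ≤ 1) (hk : 1 + b ≤ S.card * (a - b)) :
    ∃ c > 0, ∀ w, (∀ p ∈ S, w ≠ p) →
      c * ∏ p ∈ S, coneDensity a b (normSq (w - p)) ≤
        ∑ p ∈ S, coneCurvature b (normSq (w - p)) := by
  obtain ⟨δ, hδ, hsep⟩ := S.exists_pos_forall_normSq_sub_ge
  set κ := min δ 1 / 2 with hκdef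
  have hκ : 0 < κ := by positivity
  set C := coneDensity a b κ with hC
  have hC0 : 0 < C := coneDensity_pos hκ
  refine ⟨(8 * C ^ (S.card - 1))⁻¹, by positivity, fun w hw => ?_⟩
  obtain ⟨q, hq, hmin⟩ := S.exists_min_image (fun p => normSq (w - p)) hS
  set M := normSq (w - q) with hM
  have hM0 : 0 < M := normSq_pos.2 (sub_ne_zero.2 (hw q hq))
  have hfac : ∀ p ∈ S.erase q,
      coneDensity a b (normSq (w - p)) ≤ C * (1 + M) ^ (b - a) := by
    intro p hp
    have hpS := Finset.mem_of_mem_erase hp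
    have h1 : δ ≤ normSq (w - p) :=
      hsep q hq p hpS (Finset.ne_of_mem_erase hp).symm w (hmin p hpS)
    have h2 : M ≤ normSq (w - p) := hmin p hpS
    have h3 : κ * (1 + M) ≤ normSq (w - p) := by
      have h4 : min δ 1 ≤ δ := min_le_left _ _
      have h5 : min δ 1 ≤ 1 := min_le_right _ _
      rw [hκdef]; nlinarith
    exact (coneDensity_anti ha hba (by positivity) h3).trans
      (coneDensity_mul_le hb hκ (by linarith))
  have hcard : ((S.card - 1 : ℕ) : ℝ) = S.card - 1 := by
    rw [Nat.cast_sub hS.card_pos]; simp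
  have hprod : ∏ p ∈ S, coneDensity a b (normSq (w - p)) ≤
      C ^ (S.card - 1) * (coneDensity a b M * (1 + M) ^ (-((a - b) * (S.card - 1)))) := by
    rw [← Finset.mul_prod_erase S _ hq]
    calc _ ≤ coneDensity a b M * ∏ p ∈ S.erase q, (C * (1 + M) ^ (b - a)) := by
          refine mul_le_mul_of_nonneg_left (Finset.prod_le_prod
            (fun p _ => coneDensity_nonneg (normSq_nonneg _)) hfac)
            (coneDensity_nonneg (normSq_nonneg _))
      _ = _ := by
          rw [Finset.prod_const, Finset.card_erase_of_mem hq, mul_pow,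
            ← Real.rpow_mul_natCast (by positivity), hcard]
          ring_nf
  rw [inv_mul_le_iff₀ (by positivity)]
  calc _ ≤ C ^ (S.card - 1) * (8 * coneCurvature b M) :=
        hprod.trans (mul_le_mul_of_nonneg_left (coneDensity_mul_le_coneCurvature hb hab
          (by linarith) hM0) (by positivity))
    _ = 8 * C ^ (S.card - 1) * coneCurvature b M := by ring
    _ ≤ _ := by
        gcongr
        exact Finset.single_le_sum (f := fun p => coneCurvature b (normSq (w - p)))
          (fun p _ => coneCurvature_nonneg (normSq_nonneg _)) hq

/-- The pullback of a cone metric of angle `2π (1 - a)` along a function ramified to order more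
than `1 / (1 - a)` over the cone point is continuous. -/
lemma AnalyticAt.continuousAt_normSq_deriv_mul_rpow {f : ℂ → ℂ} {z₀ : ℂ} (hf : AnalyticAt ℂ f z₀)
    (hf0 : f z₀ = 0) (htop : analyticOrderAt f z₀ ≠ ⊤) {n : ℕ} (hn : n ≤ analyticOrderAt f z₀)
    {a : ℝ} (ha : 0 ≤ a) (ha1 : a < 1) (hna : 1 < n * (1 - a)) :
    ContinuousAt (fun z => normSq (deriv f z) * normSq (f z) ^ (-a)) z₀ := by
  obtain ⟨e, he⟩ := ENat.ne_top_iff_exists.1 htop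
  have hne : n ≤ e := by rw [← he] at hn; exact_mod_cast hn
  obtain ⟨u, hu, hu0, hfu⟩ := (hf.analyticOrderAt_eq_natCast).1 he.symm
  have hea : 1 < e * (1 - a) :=
    hna.trans_le (mul_le_mul_of_nonneg_right (by exact_mod_cast hne) (by linarith))
  have he2 : (1 : ℝ) < e := by nlinarith [(Nat.cast_nonneg e : (0 : ℝ) ≤ e)]
  have he2' : 1 < e := by exact_mod_cast he2
  have hd := hf.analyticOrderAt_deriv_add_one
  simp only [hf0, sub_zero, ← he] at hd
  have hd' : analyticOrderAt (deriv f) z₀ = (e - 1 : ℕ) := by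
    obtain ⟨k, hk⟩ := ENat.ne_top_iff_exists.1 (show analyticOrderAt (deriv f) z₀ ≠ ⊤ from
      fun h => by simp [h] at hd)
    rw [← hk] at hd ⊢
    norm_cast at hd ⊢
    omega
  obtain ⟨v, hv, -, hfv⟩ := (hf.deriv.analyticOrderAt_eq_natCast).1 hd'
  have heq : (fun z => normSq (deriv f z) * normSq (f z) ^ (-a)) =ᶠ[𝓝 z₀]
      fun z => normSq (z - z₀) ^ (e * (1 - a) - 1) * (normSq (v z) * normSq (u z) ^ (-a)) := by
    filter_upwards [hfu, hfv] with z h₁ h₂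
    rcases eq_or_ne z z₀ with rfl | hz
    · have : e - 1 ≠ 0 := by omega
      rw [h₂]
      simp [this, Real.zero_rpow (show e * (1 - a) - 1 ≠ 0 by linarith)]
    · have hz0 : 0 < normSq (z - z₀) := normSq_pos.2 (sub_ne_zero.2 hz)
      rw [h₁, h₂, smul_eq_mul, smul_eq_mul, map_mul, map_mul, map_pow, map_pow,
        Real.mul_rpow (by positivity) (normSq_nonneg _), ← Real.rpow_natCast, ← Real.rpow_natCast,
        ← Real.rpow_mul hz0.le]
      have : normSq (z - z₀) ^ (e * (1 - a) - 1) =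
          normSq (z - z₀) ^ ((e - 1 : ℕ) : ℝ) * normSq (z - z₀) ^ (e * -a) := by
        rw [← Real.rpow_add hz0, Nat.cast_sub he2'.le]
        push_cast; ring_nf
      rw [this]; ring
  refine ContinuousAt.congr ?_ heq.symm
  have hS {w : ℂ → ℂ} (hw : ContinuousAt w z₀) : ContinuousAt (fun z => normSq (w z)) z₀ :=
    continuous_normSq.continuousAt.comp hw
  refine ((hS (by fun_prop)).rpow_const (Or.inr (by linarith))).mul
    ((hS hv.continuousAt).mul ((hS hu.continuousAt).rpow_const (Or.inl ?_)))
  exact (normSq_pos.2 hu0).ne'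

lemma hasDerivAt_log_coneDensity {a b x : ℝ} (hx : 0 < x) :
    HasDerivAt (fun x => Real.log (coneDensity a b x))
      (-a * x⁻¹ + b * x ^ (b - 1) / (1 + x ^ b)) x := by
  have h1 : HasDerivAt (fun x => -a * Real.log x + Real.log (1 + x ^ b))
      (-a * x⁻¹ + b * x ^ (b - 1) / (1 + x ^ b)) x :=
    ((Real.hasDerivAt_log hx.ne').const_mul (-a)).fun_add
      (((Real.hasDerivAt_rpow_const (Or.inl hx.ne')).const_add 1).log (by positivity))
  refine h1.congr_of_eventuallyEq ?_
  filter_upwards [eventually_gt_nhds hx] with y hy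
  rw [coneDensity, Real.log_mul (by positivity) (by positivity), Real.log_rpow hy]

lemma exists_hasDerivAt_coneCurvature {a b x : ℝ} (hx : 0 < x) :
    ∃ c, HasDerivAt (fun x => -a * x⁻¹ + b * x ^ (b - 1) / (1 + x ^ b)) c x ∧
      (-a * x⁻¹ + b * x ^ (b - 1) / (1 + x ^ b)) + x * c = b ^ 2 * coneCurvature b x := by
  refine ⟨_, ((hasDerivAt_inv hx.ne').const_mul (-a)).fun_add
    (((Real.hasDerivAt_rpow_const (p := b - 1) (Or.inl hx.ne')).const_mul b).fun_div
      ((Real.hasDerivAt_rpow_const (p := b) (Or.inl hx.ne')).const_add 1) (by positivity)), ?_⟩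
  have h1 : x ^ b = x ^ (b - 1) * x := by
    rw [← Real.rpow_add_one hx.ne']; ring_nf
  have h2 : x ^ (b - 1) = x ^ (b - 1 - 1) * x := by
    rw [← Real.rpow_add_one hx.ne']; ring_nf
  have h3 : 0 < 1 + x ^ b := by positivity
  rw [coneCurvature]
  rw [h1] at h3 ⊢
  rw [h2] at h3 ⊢
  generalize x ^ (b - 1 - 1) = y at *
  have h4 : 1 + x ^ 2 * y ≠ 0 := by convert h3.ne' using 1; ring
  have h5 : y * x * x = x ^ 2 * y := by ring
  rw [h5]
  field_simp
  ring

/-- The Ahlfors lemma for the pullback of the cone metric along `g` and the hyperbolic metric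
on the disc of radius `√X`, at a maximum point of their quotient. -/
lemma mul_sum_coneCurvature_le_of_isLocalMax {g : ℂ → ℂ} (hg : Differentiable ℂ g)
    {S : Finset ℂ} {a b X : ℝ} {z₀ : ℂ} (hX : normSq z₀ < X) (hd : deriv g z₀ ≠ 0)
    (hgS : ∀ p ∈ S, g z₀ ≠ p)
    (hmax : IsLocalMax (fun z => (X - normSq z) ^ 2 *
      (normSq (deriv g z) * ∏ p ∈ S, coneDensity a b (normSq (g z - p)))) z₀) :
    normSq (deriv g z₀) * (b ^ 2 * ∑ p ∈ S, coneCurvature b (normSq (g z₀ - p))) ≤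
      2 * X / (X - normSq z₀) ^ 2 := by
  have hgan : AnalyticAt ℂ g z₀ := hg.analyticAt z₀
  have hNd : 0 < normSq (deriv g z₀) := normSq_pos.2 hd
  have hNp : ∀ p ∈ S, 0 < normSq (g z₀ - p) := fun p hp => normSq_pos.2 (sub_ne_zero.2 (hgS p hp))
  have hcurv : ∀ p : ℂ, ∃ c, p ∈ S →
      HasDerivAt (fun x => -a * x⁻¹ + b * x ^ (b - 1) / (1 + x ^ b)) c (normSq (g z₀ - p)) ∧
      (-a * (normSq (g z₀ - p))⁻¹ + b * (normSq (g z₀ - p)) ^ (b - 1) /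
        (1 + (normSq (g z₀ - p)) ^ b)) + normSq (g z₀ - p) * c =
          b ^ 2 * coneCurvature b (normSq (g z₀ - p)) := by
    intro p
    by_cases hp : p ∈ S
    · obtain ⟨c, hc⟩ := exists_hasDerivAt_coneCurvature (a := a) (b := b) (hNp p hp)
      exact ⟨c, fun _ => hc⟩
    · exact ⟨0, fun h => (hp h).elim⟩
  choose c hc using hcurv
  let u : Option (Option ℂ) → ℂ → ℂ := fun j =>
    j.elim id fun j => j.elim (deriv g) fun p z => g z - p
  let φ : Option (Option ℂ) → ℝ → ℝ := fun j =>
    j.elim (fun x => 2 * Real.log (X - x)) fun j => j.elim Real.log fun _ x =>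
      Real.log (coneDensity a b x)
  let φ' : Option (Option ℂ) → ℝ → ℝ := fun j =>
    j.elim (fun x => 2 * (-1 / (X - x))) fun j => j.elim (fun x => x⁻¹) fun _ x =>
      -a * x⁻¹ + b * x ^ (b - 1) / (1 + x ^ b)
  let φ'' : Option (Option ℂ) → ℝ := fun j =>
    j.elim (-2 / (X - normSq z₀) ^ 2) fun j =>
      j.elim (-(normSq (deriv g z₀) ^ 2)⁻¹) c
  have hmem (p : ℂ) : some (some p) ∈ S.insertNone.insertNone ↔ p ∈ S := by simp
  have key := sum_normSq_deriv_mul_nonpos_of_isLocalMax (J := S.insertNone.insertNone) (u := u)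
    (φ := φ) (φ' := φ') (c := φ'') (z₀ := z₀) ?_ ?_ ?_ ?_
  · simp only [Finset.sum_insertNone, u, φ', φ'', Option.elim, deriv_id, deriv_sub_const, id,
      map_one, one_mul] at key
    rw [Finset.sum_congr rfl fun p hp => by rw [(hc p hp).2], ← Finset.mul_sum,
      ← Finset.mul_sum] at key
    have h1 : 2 * (-1 / (X - normSq z₀)) + normSq z₀ * (-2 / (X - normSq z₀) ^ 2) =
        -(2 * X / (X - normSq z₀) ^ 2) := by
      have : X - normSq z₀ ≠ 0 := by linarith
      field_simp
      ring
    have h2 : (normSq (deriv g z₀))⁻¹ +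
        normSq (deriv g z₀) * -(normSq (deriv g z₀) ^ 2)⁻¹ = 0 := by
      field_simp
      ring
    rw [h1, h2] at key
    linarith
  · rintro (_ | _ | p) hj
    · exact analyticAt_id
    · exact hgan.deriv
    · exact hgan.sub analyticAt_const
  · rintro (_ | _ | p) hj
    · filter_upwards [eventually_lt_nhds hX] with x hx
      exact (((hasDerivAt_id x).const_sub X).log (sub_pos.2 hx).ne').const_mul 2
    · filter_upwards [eventually_gt_nhds hNd] with x hx using Real.hasDerivAt_log hx.ne'
    · filter_upwards [eventually_gt_nhds (hNp p ((hmem p).1 hj))] with x hx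
      exact hasDerivAt_log_coneDensity hx
  · rintro (_ | _ | p) hj
    · have h : X - normSq z₀ ≠ 0 := by linarith
      refine (((hasDerivAt_const _ (-1 : ℝ)).fun_div
        ((hasDerivAt_id (normSq z₀)).const_sub X) h).const_mul 2).congr_deriv ?_
      simp [φ'']
      ring
    · exact hasDerivAt_inv hNd.ne'
    · exact (hc p ((hmem p).1 hj)).1
  · have hS {w : ℂ → ℂ} (hw : Continuous w) : Continuous fun z => normSq (w z) :=
      continuous_normSq.comp hw
    have hgd : Continuous (deriv g) := hg.deriv.continuous
    have h1 : ∀ᶠ z in 𝓝 z₀, normSq z < X :=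
      continuous_normSq.continuousAt.eventually_lt continuousAt_const hX
    have h2 : ∀ᶠ z in 𝓝 z₀, 0 < normSq (deriv g z) :=
      continuousAt_const.eventually_lt (hS hgd).continuousAt hNd
    have h3 : ∀ᶠ z in 𝓝 z₀, ∀ p ∈ S, 0 < normSq (g z - p) :=
      (Filter.eventually_all_finset S).2 fun p hp => continuousAt_const.eventually_lt
        (hS (hg.continuous.sub continuous_const)).continuousAt (hNp p hp)
    have hlog : ∀ z, normSq z < X → 0 < normSq (deriv g z) → (∀ p ∈ S, 0 < normSq (g z - p)) →
        0 < (X - normSq z) ^ 2 *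
          (normSq (deriv g z) * ∏ p ∈ S, coneDensity a b (normSq (g z - p))) ∧
        ∑ j ∈ S.insertNone.insertNone, φ j (normSq (u j z)) =
          Real.log ((X - normSq z) ^ 2 *
            (normSq (deriv g z) * ∏ p ∈ S, coneDensity a b (normSq (g z - p)))) := by
      intro z h1 h2 h3
      have h4 : 0 < (X - normSq z) ^ 2 := pow_pos (sub_pos.2 h1) 2
      have h5 : ∀ p ∈ S, 0 < coneDensity a b (normSq (g z - p)) :=
        fun p hp => coneDensity_pos (h3 p hp)
      have h6 := Finset.prod_pos h5
      refine ⟨mul_pos h4 (mul_pos h2 h6), ?_⟩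
      rw [Real.log_mul h4.ne' (mul_pos h2 h6).ne', Real.log_mul h2.ne' h6.ne',
        Real.log_prod fun p hp => (h5 p hp).ne', Real.log_pow]
      simp [Finset.sum_insertNone, u, φ]
    filter_upwards [h1, h2, h3, hmax] with z h1 h2 h3 h4
    obtain ⟨hpos, heq⟩ := hlog z h1 h2 h3
    rw [heq, (hlog z₀ hX hNd hNp).2]
    exact Real.log_le_log hpos h4

/-- An entire function which is ramified to order at least `n` over each point of a finite set
is constant, provided the set is large enough. -/
theorem deriv_eq_zero_of_le_analyticOrderAt {g : ℂ → ℂ} (hg : Differentiable ℂ g)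
    {S : Finset ℂ} {a b : ℝ} (hb : 0 < b) (hab : a + b ≤ 1)
    (hk : 1 + b ≤ S.card * (a - b)) {n : ℕ} (hn : 1 < n * (1 - a))
    (hram : ∀ p ∈ S, ∀ z, g z = p → n ≤ analyticOrderAt (fun z => g z - p) z) (z₁ : ℂ) :
    deriv g z₁ = 0 := by
  by_contra hz₁
  have hba : b < a := by
    by_contra! h
    have : S.card * (a - b) ≤ 0 := mul_nonpos_of_nonneg_of_nonpos (by positivity) (by linarith)
    linarith
  have hS : S.Nonempty := by
    rw [Finset.nonempty_iff_ne_empty]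
    rintro rfl
    simp at hk; linarith
  have hn2 : 1 < n := by
    have : (1 : ℝ) < n := by nlinarith [(Nat.cast_nonneg n : (0 : ℝ) ≤ n)]
    exact_mod_cast this
  have hgan (p z : ℂ) : AnalyticAt ℂ (fun z => g z - p) z :=
    (hg.analyticAt z).sub analyticAt_const
  have htop (p z : ℂ) : analyticOrderAt (fun z => g z - p) z ≠ ⊤ := by
    intro h
    have h1 := AnalyticOnNhd.eq_of_eventuallyEq (fun x _ => hgan p x)
      (fun x _ => analyticAt_const) (analyticOrderAt_eq_top.1 h)
    have h2 : g = fun _ => p := funext fun x => sub_eq_zero.1 (congrFun h1 x)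
    exact hz₁ (by rw [h2]; simp)
  have hds (p z : ℂ) : deriv (fun z => g z - p) z = deriv g z := deriv_sub_const p
  have hgS : ∀ z, deriv g z ≠ 0 → ∀ p ∈ S, g z ≠ p := by
    intro z hz p hp hzp
    have h1 := hram p hp z hzp
    rw [(hgan p z).analyticOrderAt_eq_one_of_zero_deriv_ne_zero (by simp [hzp])
      (by rwa [hds])] at h1
    have : n ≤ 1 := by exact_mod_cast h1
    omega
  set K : ℂ → ℝ := fun z =>
    normSq (deriv g z) * ∏ p ∈ S, coneDensity a b (normSq (g z - p)) with hK
  have hKpos : ∀ z, deriv g z ≠ 0 → 0 < K z := fun z hz =>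
    mul_pos (normSq_pos.2 hz) (Finset.prod_pos fun p hp =>
      coneDensity_pos (normSq_pos.2 (sub_ne_zero.2 (hgS z hz p hp))))
  have hKcont : Continuous K := by
    refine continuous_iff_continuousAt.2 fun z => ?_
    have hN (p : ℂ) : ContinuousAt (fun z => normSq (g z - p)) z :=
      (continuous_normSq.comp (hg.continuous.sub continuous_const)).continuousAt
    have hNb (p : ℂ) : ContinuousAt (fun z => 1 + normSq (g z - p) ^ b) z :=
      continuousAt_const.add ((hN p).rpow_const (Or.inr hb.le))
    have hreg {T : Finset ℂ} (hT : ∀ p ∈ T, g z ≠ p) :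
        ContinuousAt (fun z => ∏ p ∈ T, coneDensity a b (normSq (g z - p))) z := by
      refine tendsto_finsetProd T fun p hp => ?_
      exact ((hN p).rpow_const (Or.inl (normSq_pos.2 (sub_ne_zero.2 (hT p hp))).ne')).mul (hNb p)
    by_cases h : ∀ p ∈ S, g z ≠ p
    · exact (continuous_normSq.comp hg.deriv.continuous).continuousAt.mul (hreg h)
    · push Not at h
      obtain ⟨p, hp, rfl⟩ := h
      have h1 := (hgan (g z) z).continuousAt_normSq_deriv_mul_rpow (sub_self _) (htop _ _)
        (hram _ hp z rfl) (hb.trans hba).le (by linarith) hn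
      have h2 := (h1.mul (hNb (g z))).mul
        (hreg (T := S.erase (g z)) fun p hp => (Finset.ne_of_mem_erase hp).symm)
      refine h2.congr (Eventually.of_forall fun w => ?_)
      simp only [hK, hds, ← Finset.mul_prod_erase S _ hp, coneDensity, Pi.mul_apply]
      ring
  obtain ⟨c, hc, hcurv⟩ :=
    exists_mul_prod_coneDensity_le hS (hb.trans hba).le hb.le hba.le hab hk
  have hbound : ∀ X, normSq z₁ < X → (X - normSq z₁) ^ 2 * K z₁ ≤ 2 * X / (b ^ 2 * c) := by
    intro X hX
    have hX0 : 0 < X := (normSq_nonneg z₁).trans_lt hX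
    have hball (z : ℂ) : z ∈ Metric.closedBall (0 : ℂ) (√X) ↔ normSq z ≤ X := by
      rw [mem_closedBall_zero_iff, normSq_eq_norm_sq, Real.le_sqrt (norm_nonneg _) hX0.le]
    obtain ⟨z₀, hz₀, hmax⟩ := (isCompact_closedBall (0 : ℂ) (√X)).exists_isMaxOn
      ⟨z₁, (hball z₁).2 hX.le⟩
      (f := fun z => (X - normSq z) ^ 2 * K z)
      (((continuous_const.sub continuous_normSq).pow 2).mul hKcont).continuousOn
    have hle : (X - normSq z₁) ^ 2 * K z₁ ≤ (X - normSq z₀) ^ 2 * K z₀ := hmax ((hball z₁).2 hX.le)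
    have hpos : 0 < (X - normSq z₀) ^ 2 * K z₀ :=
      (mul_pos (pow_pos (sub_pos.2 hX) 2) (hKpos z₁ hz₁)).trans_le hle
    have hd : deriv g z₀ ≠ 0 := by
      intro h
      simp [hK, h] at hpos
    have hlt : normSq z₀ < X := by
      refine ((hball z₀).1 hz₀).lt_of_ne fun h => ?_
      simp [h] at hpos
    have hloc : IsLocalMax (fun z => (X - normSq z) ^ 2 * K z) z₀ := by
      filter_upwards [continuous_normSq.continuousAt.eventually_lt continuousAt_const hlt]
        with z hz using hmax ((hball z).2 hz.le)
    have h1 := mul_sum_coneCurvature_le_of_isLocalMax hg hlt hd (hgS z₀ hd) hloc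
    have h2 : b ^ 2 * c * K z₀ ≤ 2 * X / (X - normSq z₀) ^ 2 := by
      refine le_trans ?_ h1
      calc b ^ 2 * c * K z₀ = normSq (deriv g z₀) *
            (b ^ 2 * (c * ∏ p ∈ S, coneDensity a b (normSq (g z₀ - p)))) := by
              simp only [hK]; ring
        _ ≤ _ := by
          gcongr
          · exact normSq_nonneg _
          · exact hcurv _ (hgS z₀ hd)
    have h3 : 0 < (X - normSq z₀) ^ 2 := pow_pos (sub_pos.2 hlt) 2
    refine hle.trans ?_
    rw [le_div_iff₀ h3] at h2
    rw [le_div_iff₀ (by positivity)]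
    linarith
  set N := normSq z₁ with hN
  have hN0 : 0 ≤ N := normSq_nonneg z₁
  have hK0 : 0 < K z₁ := hKpos z₁ hz₁
  set D := 8 / (b ^ 2 * c * K z₁) with hD
  have hD0 : 0 < D := by positivity
  have h1 := hbound (2 * N + D + 1) (by linarith)
  rw [le_div_iff₀ (by positivity)] at h1
  have h2 : b ^ 2 * c * K z₁ = 8 / D := by rw [hD]; field_simp
  have h3 : (2 * N + D + 1 - N) ^ 2 * (b ^ 2 * c * K z₁) ≤ 2 * (2 * N + D + 1) := by linarith
  rw [h2, mul_div_assoc', div_le_iff₀ hD0] at h3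
  nlinarith [mul_nonneg hN0 hD0.le, sq_nonneg N]

lemma dvd_mul_of_pow_eq_pow_mul {f h k : ℂ → ℂ} {z : ℂ} (hf : AnalyticAt ℂ f z)
    (hh : AnalyticAt ℂ h z) (hk : AnalyticAt ℂ k z) (hkz : k z ≠ 0) {a d e : ℕ} (hd : d ≠ 0)
    (heq : h ^ d = f ^ a * k) (he : analyticOrderAt f z = e) : d ∣ a * e := by
  have h1 := analyticOrderAt_pow hh d
  rw [heq, analyticOrderAt_mul (hf.pow a) hk, analyticOrderAt_pow hf, he,
    hk.analyticOrderAt_eq_zero.2 hkz, add_zero] at h1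
  obtain ⟨r, hr⟩ := ENat.ne_top_iff_exists.1 (show analyticOrderAt h z ≠ ⊤ from fun ht => by
    rw [ht, nsmul_eq_mul, nsmul_eq_mul, ENat.mul_top (by exact_mod_cast hd)] at h1
    exact ENat.natCast_ne_top (a * e) (by exact_mod_cast h1))
  rw [← hr, nsmul_eq_mul, nsmul_eq_mul] at h1
  exact ⟨r, by exact_mod_cast h1⟩

lemma Finset.mul_card_filter_dvd_add_card_le_sum {ι : Type*} [Fintype ι] {a : ι → ℕ}
    (ha : ∀ i, 0 < a i) (d : ℕ) :
    d * (univ.filter fun i => d ∣ a i).card + (univ.filter fun i => ¬ d ∣ a i).card ≤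
      ∑ i, a i := by
  rw [← Finset.sum_filter_add_sum_filter_not univ (fun i => d ∣ a i) a]
  refine add_le_add ?_ ?_
  · rw [mul_comm, ← smul_eq_mul]
    exact Finset.card_nsmul_le_sum _ _ _ fun i hi =>
      Nat.le_of_dvd (ha i) (Finset.mem_filter.1 hi).2
  · simpa using Finset.card_nsmul_le_sum (univ.filter fun i => ¬ d ∣ a i) a 1 fun i _ => ha i

/-- Brody hyperbolicity of the degree `d` cyclic cover of 𝔸¹ branched along
`a₁ p₁ + ⋯ + a_l p_l`: under the numerical conditions, any entire solution of
`h^d = ∏ (g - pᵢ)^{aᵢ}` has both `g` and `h` constant. -/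
theorem cyclic_cover_A1_brody_hyperbolic
    (d l m : ℕ) (hd : 2 ≤ d) (hl : 0 < l) (hm : 0 < m) (hdm : d ∣ m)
    (p : Fin l → ℂ) (hp : Function.Injective p)
    (a : Fin l → ℕ) (ha : ∀ i, 0 < a i) (hsum : ∑ i, a i = m)
    (hcase : (Even d ∧ m / d + 2 ≤ l) ∨ (Odd d ∧ m / d + 1 ≤ l))
    (g h : ℂ → ℂ) (hg : Differentiable ℂ g) (hh : Differentiable ℂ h)
    (heq : ∀ z : ℂ, h z ^ d = ∏ i, (g z - p i) ^ a i) :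
    (∀ z : ℂ, g z = g 0) ∧ (∀ z : ℂ, h z = h 0) := by
  classical
  suffices hgc : ∀ z, g z = g 0 by
    refine ⟨hgc, fun z => hh.apply_eq_apply_of_bounded ?_ z 0⟩
    have hpow : ∀ z, ‖h z‖ ^ d = ‖h 0‖ ^ d := fun z => by
      rw [← norm_pow, ← norm_pow, heq, heq, hgc]
    refine isBounded_iff_forall_norm_le.2 ⟨‖h 0‖, ?_⟩
    rintro _ ⟨z, rfl⟩
    exact le_of_eq ((pow_left_inj₀ (norm_nonneg _) (norm_nonneg _) (by omega)).1 (hpow z))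
  set T := Finset.univ.filter fun i => ¬ d ∣ a i with hT
  have hdvd : ∀ i, ∀ z, g z = p i → ∀ e : ℕ,
      analyticOrderAt (fun z => g z - p i) z = e → d ∣ a i * e := by
    intro i z hz e he
    have han (j : Fin l) : AnalyticAt ℂ (fun z => g z - p j) z :=
      (hg.analyticAt z).sub analyticAt_const
    refine dvd_mul_of_pow_eq_pow_mul (han i) (hh.analyticAt z)
      (k := fun z => ∏ j ∈ Finset.univ.erase i, (g z - p j) ^ a j)
      (Finset.analyticAt_fun_prod _ fun j _ => (han j).fun_pow _) ?_ (by omega) ?_ he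
    · refine Finset.prod_ne_zero_iff.2 fun j hj => pow_ne_zero _ (sub_ne_zero.2 ?_)
      rw [hz]
      exact fun hij => Finset.ne_of_mem_erase hj (hp hij).symm
    · funext w
      simp only [Pi.pow_apply, Pi.mul_apply, heq,
        Finset.mul_prod_erase Finset.univ (fun j => (g w - p j) ^ a j) (Finset.mem_univ i)]
  have hcardS : (T.image p).card = T.card := Finset.card_image_of_injective _ hp
  have hle : ∀ n : ℕ, (∀ i ∈ T, ∀ e : ℕ, e ≠ 0 → d ∣ a i * e → n ≤ e) →
      ∀ q ∈ T.image p, ∀ z, g z = q → n ≤ analyticOrderAt (fun z => g z - q) z := by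
    intro n hn q hq z hz
    obtain ⟨i, hi, rfl⟩ := Finset.mem_image.1 hq
    by_cases htop : analyticOrderAt (fun z => g z - p i) z = ⊤
    · simp [htop]
    · obtain ⟨e, he⟩ := ENat.ne_top_iff_exists.1 htop
      rw [← he]
      have he0 : e ≠ 0 := by
        rintro rfl
        refine ((hg.analyticAt z).sub analyticAt_const).analyticOrderAt_ne_zero.2 ?_ he.symm
        exact sub_eq_zero.2 hz
      exact_mod_cast hn i hi e he0 (hdvd i z hz e he.symm)
  have hcount := Finset.mul_card_filter_dvd_add_card_le_sum ha d
  have hcompl := Finset.card_filter_add_card_filter_not (s := Finset.univ) fun i => d ∣ a i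
  rw [Finset.card_univ, Fintype.card_fin] at hcompl
  rw [hsum] at hcount
  rw [← hT] at hcount hcompl
  obtain ⟨q, rfl⟩ := hdm
  rw [Nat.mul_div_cancel_left q (by omega)] at hcase
  have hnd : ∀ i ∈ T, ¬ d ∣ a i := fun i hi => (Finset.mem_filter.1 hi).2
  have hconst : (∀ z, deriv g z = 0) → ∀ z, g z = g 0 := fun hz z =>
    is_const_of_deriv_eq_zero hg hz z 0
  refine hconst ?_
  rcases hcase with ⟨-, hql⟩ | ⟨hodd, hql⟩
  · have hcard : 3 ≤ T.card := by
      by_contra! h3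
      generalize (Finset.univ.filter fun i => d ∣ a i).card = c at *
      nlinarith
    have hcard' : (3 : ℝ) ≤ (T.image p).card := by rw [hcardS]; exact_mod_cast hcard
    refine deriv_eq_zero_of_le_analyticOrderAt hg (a := 2 / 5) (b := 1 / 20) (n := 2)
      (by norm_num) (by norm_num) (by linarith) (by norm_num) (hle 2 fun i hi e he hde => ?_)
    by_contra! h2
    obtain rfl : e = 1 := by omega
    exact hnd i hi (by simpa using hde)
  · have hcard : 2 ≤ T.card := by
      by_contra! h3
      generalize (Finset.univ.filter fun i => d ∣ a i).card = c at *
      nlinarith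
    have hcard' : (2 : ℝ) ≤ (T.image p).card := by rw [hcardS]; exact_mod_cast hcard
    refine deriv_eq_zero_of_le_analyticOrderAt hg (a := 3 / 5) (b := 1 / 20) (n := 3)
      (by norm_num) (by norm_num) (by linarith) (by norm_num) (hle 3 fun i hi e he hde => ?_)
    by_contra! h3
    obtain rfl | rfl : e = 1 ∨ e = 2 := by omega
    · exact hnd i hi (by simpa using hde)
    · exact hnd i hi (hodd.coprime_two_right.dvd_of_dvd_mul_right hde)
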